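/- Let H be a complex Hilbert space and let π : 𝔐 → B(H) be a continuous unital star-algebra homomorphism that is irreducible, i.e. the only closed subspaces of H invariant under π(x) for every x ∈ 𝔐 are {0} and H. Assume (i) there exists a nonzero vector ξ ∈ H with π(a_i) ξ = 0 for every integer i, and (ii) for every integer i and every η ∈ H the series Σ_{k ≤ i} π(a_k† a_k) η converges in H and π(a_i a_i†) η = η − Σ_{k ≤ i} π(a_k† a_k) η. Then π is unitarily equivalent to the Fock (identity) representation: there exists a unitary U : F → H such that π(x) ∘ U = U ∘ x for every x ∈ 𝔐. -/

import Mathlib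

noncomputable section

open ContinuousLinearMap
open scoped InnerProductSpace ComplexOrder

/-- The discrete monotone Fock space: `ℓ²` over the finite subsets of `ℤ`. -/
abbrev MF : Type := lp (fun _ : Finset ℤ => ℂ) 2

/-- The canonical orthonormal basis vector corresponding to a finite subset `S ⊆ ℤ`;
`eS ∅` is the vacuum vector `Ω`. -/
noncomputable def eS (S : Finset ℤ) : MF := lp.single 2 S 1

/-- `a : ℤ → MF →L[ℂ] MF` is the family of monotone annihilation operators:
`a i (eS S) = eS (S \ {i})` if `S` is nonempty with `min S = i`, and `a i (eS S) = 0`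
otherwise.  The creation operator `a_i†` is the Hilbert-space adjoint of `a i`. -/
def IsMonotoneAnnihilation (a : ℤ → MF →L[ℂ] MF) : Prop :=
  ∀ (i : ℤ) (S : Finset ℤ),
    (S.min = (i : WithBot ℤ) → a i (eS S) = eS (S.erase i)) ∧
    (S.min ≠ (i : WithBot ℤ) → a i (eS S) = 0)

/-- The monotone C*-algebra `𝔐`: the unital C*-subalgebra of `B(F)` generated by the
annihilation operators. -/
noncomputable def MonM (a : ℤ → MF →L[ℂ] MF) : StarSubalgebra ℂ (MF →L[ℂ] MF) :=
  (StarAlgebra.adjoin ℂ (Set.range a)).topologicalClosure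

lemma a_mem_MonM (a : ℤ → MF →L[ℂ] MF) (i : ℤ) : a i ∈ MonM a :=
  StarSubalgebra.le_topologicalClosure _ (StarAlgebra.subset_adjoin ℂ _ ⟨i, rfl⟩)

lemma aad_mem_MonM (a : ℤ → MF →L[ℂ] MF) (i : ℤ) :
    (a i).comp (adjoint (a i)) ∈ MonM a := by
  have h := mul_mem (a_mem_MonM a i) (star_mem (a_mem_MonM a i))
  rwa [star_eq_adjoint, mul_def] at h

lemma ada_mem_MonM (a : ℤ → MF →L[ℂ] MF) (i : ℤ) :
    (adjoint (a i)).comp (a i) ∈ MonM a := by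
  have h := mul_mem (star_mem (a_mem_MonM a i)) (a_mem_MonM a i)
  rwa [star_eq_adjoint, mul_def] at h

lemma inner_eS_left (S : Finset ℤ) (v : MF) : ⟪eS S, v⟫_ℂ = v S := by
  rw [eS, lp.inner_single_left]
  simp

lemma eS_apply (S T : Finset ℤ) : (eS S : MF) T = if T = S then 1 else 0 := by
  rw [eS, lp.single_apply, Pi.single_apply]

lemma continuousLinearMap_ext_eS {E : Type*} [NormedAddCommGroup E] [NormedSpace ℂ E]
    {f g : MF →L[ℂ] E} (h : ∀ S, f (eS S) = g (eS S)) : f = g := by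
  refine lp.ext_continuousLinearMap (by simp) fun S => ?_
  ext
  exact h S

lemma min_insert_of_forall_lt {j : ℤ} {S : Finset ℤ} (hj : ∀ x ∈ S, j < x) :
    (insert j S).min = (j : WithTop ℤ) := by
  rw [Finset.min_insert, min_eq_left]
  exact Finset.le_min fun x hx => WithTop.coe_le_coe.2 (hj x hx).le

lemma insert_eq_insert_iff_of_forall_lt {i j : ℤ} {S T : Finset ℤ} (hi : ∀ x ∈ S, i < x)
    (hj : ∀ x ∈ T, j < x) : insert i S = insert j T ↔ i = j ∧ S = T := by
  refine ⟨fun h => ?_, fun ⟨h, h'⟩ => by rw [h, h']⟩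
  obtain rfl : i = j := by
    have := congrArg Finset.min h
    rwa [min_insert_of_forall_lt hi, min_insert_of_forall_lt hj, WithTop.coe_inj] at this
  refine ⟨rfl, ?_⟩
  rw [← Finset.erase_insert (fun hx => (hi _ hx).false), h,
    Finset.erase_insert (fun hx => (hj _ hx).false)]

namespace IsMonotoneAnnihilation

variable {a : ℤ → MF →L[ℂ] MF} (ha : IsMonotoneAnnihilation a)
include ha

lemma apply_eS_empty (i : ℤ) : a i (eS ∅) = 0 :=
  (ha i ∅).2 WithTop.top_ne_coe

lemma apply_eS_insert {j : ℤ} {S : Finset ℤ} (hj : ∀ x ∈ S, j < x) (i : ℤ) :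
    a i (eS (insert j S)) = if i = j then eS S else 0 := by
  split_ifs with h
  · subst h
    rw [(ha i _).1 (min_insert_of_forall_lt hj), Finset.erase_insert fun hx => (hj _ hx).false]
  · refine (ha i _).2 fun h' => h ?_
    exact (WithTop.coe_inj.1 ((min_insert_of_forall_lt hj).symm.trans h')).symm

open Classical in
lemma adjoint_apply_eS (i : ℤ) (S : Finset ℤ) :
    adjoint (a i) (eS S) = if ∀ x ∈ S, i < x then eS (insert i S) else 0 := by
  ext T
  rw [← inner_eS_left T, adjoint_inner_right]
  induction T using Finset.induction_on_min with
  | empty =>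
    rw [ha.apply_eS_empty, inner_zero_left]
    split_ifs
    · simp [eS_apply, (Finset.insert_ne_empty i S).symm]
    · simp
  | insert j T hj _ =>
    rw [ha.apply_eS_insert hj]
    split_ifs with hij hS hS
    · subst hij
      simp [inner_eS_left, eS_apply, insert_eq_insert_iff_of_forall_lt hj hS]
    · have : T ≠ S := by
        rintro rfl
        exact hS (hij ▸ hj)
      simp [inner_eS_left, eS_apply, this]
    · simp [eS_apply, insert_eq_insert_iff_of_forall_lt hj hS, Ne.symm hij]
    · simp

lemma mul_adjoint_of_ne {i j : ℤ} (hij : i ≠ j) : a i * star (a j) = 0 := by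
  refine continuousLinearMap_ext_eS fun S => ?_
  rw [mul_apply_eq_comp, star_eq_adjoint, ha.adjoint_apply_eS]
  split_ifs with h
  · simp [ha.apply_eS_insert h, hij]
  · simp

lemma adjoint_mul_adjoint_of_le {i j : ℤ} (hij : j ≤ i) : star (a i) * star (a j) = 0 := by
  refine continuousLinearMap_ext_eS fun S => ?_
  rw [mul_apply_eq_comp, star_eq_adjoint, star_eq_adjoint, ha.adjoint_apply_eS]
  split_ifs with h
  · simp [ha.adjoint_apply_eS, hij]
  · simp

end IsMonotoneAnnihilation

section Intertwiner

variable {H : Type*} [NormedAddCommGroup H] [InnerProductSpace ℂ H]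

/-- The vector obtained from `ξ` by applying the operators `C i`, `i ∈ S`, in decreasing order
of the index, so that the operator with the smallest index is applied last. -/
def monotoneVector (C : ℤ → H →L[ℂ] H) (ξ : H) (S : Finset ℤ) : H :=
  (S.sort (· ≤ ·)).foldr (fun i v => C i v) ξ

lemma monotoneVector_empty (C : ℤ → H →L[ℂ] H) (ξ : H) : monotoneVector C ξ ∅ = ξ := by
  simp [monotoneVector]

lemma monotoneVector_insert (C : ℤ → H →L[ℂ] H) (ξ : H) {i : ℤ} {S : Finset ℤ}
    (hi : ∀ x ∈ S, i < x) :
    monotoneVector C ξ (insert i S) = C i (monotoneVector C ξ S) := by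
  rw [monotoneVector, Finset.sort_insert (r := (· ≤ ·)) (fun x hx => (hi x hx).le)
    (fun hx => (hi _ hx).false)]
  rfl

variable [CompleteSpace H] {D : ℤ → H →L[ℂ] H} {ξ : H}
  (hne : ∀ i j, i ≠ j → ∀ v, D i (adjoint (D j) v) = 0)
  (hle : ∀ i j, j ≤ i → ∀ v, adjoint (D i) (adjoint (D j) v) = 0)
  (hvac : ∀ i v, (∀ k ≤ i, D k v = 0) → D i (adjoint (D i) v) = v)
  (hξ : ∀ i, D i ξ = 0)

include hne hvac hξ in
lemma annihilate_monotoneVector_insert {j : ℤ} {S : Finset ℤ} (hj : ∀ x ∈ S, j < x) (i : ℤ) :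
    D i (monotoneVector (fun k => adjoint (D k)) ξ (insert j S)) =
      if i = j then monotoneVector (fun k => adjoint (D k)) ξ S else 0 := by
  rw [monotoneVector_insert _ _ hj]
  split_ifs with h
  · subst h
    refine hvac _ _ fun k hk => ?_
    induction S using Finset.induction_on_min with
    | empty => rw [monotoneVector_empty, hξ]
    | insert m S hm _ =>
      rw [monotoneVector_insert _ _ hm]
      exact hne _ _ (hk.trans_lt (hj m (Finset.mem_insert_self m S))).ne _
  · exact hne _ _ h _

include hle in
open Classical in
lemma create_monotoneVector (i : ℤ) (S : Finset ℤ) :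
    adjoint (D i) (monotoneVector (fun k => adjoint (D k)) ξ S) =
      if ∀ x ∈ S, i < x then monotoneVector (fun k => adjoint (D k)) ξ (insert i S) else 0 := by
  split_ifs with h
  · rw [monotoneVector_insert _ _ h]
  · induction S using Finset.induction_on_min with
    | empty => simp at h
    | insert m S hm _ =>
      rw [monotoneVector_insert _ _ hm]
      refine hle _ _ (not_lt.1 fun him => h fun x hx => ?_) _
      rcases Finset.mem_insert.1 hx with rfl | hx
      · exact him
      · exact him.trans (hm x hx)

include hne hvac hξ in
lemma orthonormal_monotoneVector (hnorm : ‖ξ‖ = 1) :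
    Orthonormal ℂ (monotoneVector (fun k => adjoint (D k)) ξ) := by
  rw [orthonormal_iff_ite]
  intro S
  induction S using Finset.induction_on_min with
  | empty =>
    intro T
    induction T using Finset.induction_on_min with
    | empty => simp [monotoneVector_empty, inner_self_eq_norm_sq_to_K, hnorm]
    | insert j T hj _ =>
      rw [monotoneVector_empty, monotoneVector_insert _ _ hj, adjoint_inner_right, hξ]
      simp [(Finset.insert_ne_empty j T).symm]
  | insert i S hi ih =>
    intro T
    rw [monotoneVector_insert _ _ hi, adjoint_inner_left]
    induction T using Finset.induction_on_min with
    | empty => simp [monotoneVector_empty, hξ]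
    | insert j T hj _ =>
      rw [annihilate_monotoneVector_insert hne hvac hξ hj]
      simp only [insert_eq_insert_iff_of_forall_lt hi hj]
      split_ifs with h h' h'
      · rw [ih, if_pos h'.2]
      · rw [ih, if_neg fun h'' => h' ⟨h, h''⟩]
      · exact absurd h'.1 h
      · simp

lemma exists_linearIsometry_eS {f : Finset ℤ → H} (hf : Orthonormal ℂ f) :
    ∃ V : MF →ₗᵢ[ℂ] H, ∀ S, V (eS S) = f S := by
  refine ⟨hf.orthogonalFamily.linearIsometry, fun S => ?_⟩
  rw [eS, OrthogonalFamily.linearIsometry_apply_single]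
  simp

include hne hle hvac hξ in
lemma exists_intertwiner {a : ℤ → MF →L[ℂ] MF} (ha : IsMonotoneAnnihilation a)
    (hnorm : ‖ξ‖ = 1) :
    ∃ V : MF →ₗᵢ[ℂ] H, ∀ i v, D i (V v) = V (a i v) ∧
      adjoint (D i) (V v) = V (adjoint (a i) v) := by
  classical
  obtain ⟨V, hV⟩ := exists_linearIsometry_eS (orthonormal_monotoneVector hne hvac hξ hnorm)
  refine ⟨V, fun i v => ⟨?_, ?_⟩⟩
  · suffices D i ∘L V.toContinuousLinearMap = V.toContinuousLinearMap ∘L a i from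
      DFunLike.congr_fun this v
    refine continuousLinearMap_ext_eS fun S => ?_
    simp only [comp_apply, LinearIsometry.coe_toContinuousLinearMap, hV]
    induction S using Finset.induction_on_min with
    | empty => rw [monotoneVector_empty, hξ, ha.apply_eS_empty, map_zero]
    | insert j S hj _ =>
      rw [annihilate_monotoneVector_insert hne hvac hξ hj, ha.apply_eS_insert hj, apply_ite V,
        map_zero, hV]
  · suffices adjoint (D i) ∘L V.toContinuousLinearMap =
        V.toContinuousLinearMap ∘L adjoint (a i) from DFunLike.congr_fun this v
    refine continuousLinearMap_ext_eS fun S => ?_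
    simp only [comp_apply, LinearIsometry.coe_toContinuousLinearMap, hV]
    rw [create_monotoneVector hle, ha.adjoint_apply_eS, apply_ite V, map_zero, hV]

lemma intertwines_of_generators {a : ℤ → MF →L[ℂ] MF}
    {π : ↥(MonM a) →⋆ₐ[ℂ] (H →L[ℂ] H)} (hπ : Continuous π) (V : MF →L[ℂ] H)
    (hV : ∀ i v, π ⟨a i, a_mem_MonM a i⟩ (V v) = V (a i v) ∧
      adjoint (π ⟨a i, a_mem_MonM a i⟩) (V v) = V (adjoint (a i) v))
    (x : ↥(MonM a)) (v : MF) : π x (V v) = V ((x : MF →L[ℂ] MF) v) := by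
  have key : ∀ (y : MF →L[ℂ] MF) (hy : y ∈ StarAlgebra.adjoin ℂ (Set.range a)),
      ∀ v, π ⟨y, StarSubalgebra.le_topologicalClosure _ hy⟩ (V v) = V (y v) ∧
        π (star ⟨y, StarSubalgebra.le_topologicalClosure _ hy⟩) (V v) = V (star y v) := by
    intro y hy
    induction hy using StarAlgebra.adjoin_induction with
    | mem y hy =>
      obtain ⟨i, rfl⟩ := hy
      intro v
      rw [map_star]
      exact hV i v
    | algebraMap r =>
      intro v
      have h : (⟨algebraMap ℂ _ r, StarSubalgebra.le_topologicalClosure _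
          (algebraMap_mem (StarAlgebra.adjoin ℂ (Set.range a)) r)⟩ : MonM a) = algebraMap ℂ _ r :=
        rfl
      rw [h, map_star, AlgHomClass.commutes, ← algebraMap_star_comm, ← algebraMap_star_comm]
      simp [Algebra.algebraMap_eq_smul_one]
    | add y z hy hz ihy ihz =>
      intro v
      have h : (⟨y + z, StarSubalgebra.le_topologicalClosure _ (add_mem hy hz)⟩ : MonM a) =
          ⟨y, StarSubalgebra.le_topologicalClosure _ hy⟩ +
          ⟨z, StarSubalgebra.le_topologicalClosure _ hz⟩ := rfl
      simp only [h, star_add, map_add, _root_.add_apply, ihy v, ihz v, and_self]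
    | mul y z hy hz ihy ihz =>
      intro v
      have h : (⟨y * z, StarSubalgebra.le_topologicalClosure _ (mul_mem hy hz)⟩ : MonM a) =
          ⟨y, StarSubalgebra.le_topologicalClosure _ hy⟩ *
          ⟨z, StarSubalgebra.le_topologicalClosure _ hz⟩ := rfl
      simp only [h, star_mul, map_mul, mul_apply_eq_comp, ihy, ihz, and_self]
    | star y hy ih =>
      intro v
      have h : (⟨star y, StarSubalgebra.le_topologicalClosure _ (star_mem hy)⟩ : MonM a) =
          star ⟨y, StarSubalgebra.le_topologicalClosure _ hy⟩ := rfl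
      rw [h, star_star, star_star]
      exact (ih v).symm
  have hclosed : IsClosed {x : MonM a | π x (V v) = V ((x : MF →L[ℂ] MF) v)} :=
    isClosed_eq (hπ.clm_apply continuous_const)
      (V.continuous.comp (continuous_subtype_val.clm_apply continuous_const))
  have hsub : {x : MonM a | (x : MF →L[ℂ] MF) ∈ StarAlgebra.adjoin ℂ (Set.range a)} ⊆
      {x : MonM a | π x (V v) = V ((x : MF →L[ℂ] MF) v)} := fun y hy => (key y hy v).1
  refine hclosed.closure_subset_iff.2 hsub (closure_subtype.2 ?_)
  have himage : (StarAlgebra.adjoin ℂ (Set.range a) : Set (MF →L[ℂ] MF)) ⊆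
      Subtype.val '' {x : MonM a | (x : MF →L[ℂ] MF) ∈ StarAlgebra.adjoin ℂ (Set.range a)} :=
    fun y hy => ⟨⟨y, StarSubalgebra.le_topologicalClosure _ hy⟩, hy, rfl⟩
  exact closure_mono himage x.2

end Intertwiner

/-- Any irreducible representation `π` of `𝔐` with a nonzero vector killed by all `π(a_i)`
and satisfying `π(a_i a_i†) = I − Σ_{k ≤ i} π(a_k† a_k)` (strongly) is unitarily
equivalent to the Fock representation. -/
theorem stmt10 (a : ℤ → MF →L[ℂ] MF) (ha : IsMonotoneAnnihilation a)
    (H : Type) [NormedAddCommGroup H] [InnerProductSpace ℂ H] [CompleteSpace H]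
    (π : ↥(MonM a) →⋆ₐ[ℂ] (H →L[ℂ] H)) (hπcont : Continuous π)
    (hirr : ∀ K : Submodule ℂ H, IsClosed (K : Set H) →
      (∀ x : ↥(MonM a), ∀ v ∈ K, π x v ∈ K) → K = ⊥ ∨ K = ⊤)
    (hker : ∃ ξ : H, ξ ≠ 0 ∧ ∀ i : ℤ, π ⟨a i, a_mem_MonM a i⟩ ξ = 0)
    (hsum : ∀ (i : ℤ) (η : H),
      HasSum (fun k : {k : ℤ // k ≤ i} => π ⟨(adjoint (a k)).comp (a k), ada_mem_MonM a k⟩ η)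
        (η - π ⟨(a i).comp (adjoint (a i)), aad_mem_MonM a i⟩ η)) :
    ∃ U : MF ≃ₗᵢ[ℂ] H, ∀ (x : ↥(MonM a)) (v : MF),
      π x (U v) = U ((x : MF →L[ℂ] MF) v) := by
  obtain ⟨ξ, hξ0, hξ⟩ := hker
  have hπstar (i : ℤ) : adjoint (π ⟨a i, a_mem_MonM a i⟩) = π (star ⟨a i, a_mem_MonM a i⟩) := by
    rw [map_star, star_eq_adjoint]
  have hne (i j : ℤ) (hij : i ≠ j) (v : H) :
      π ⟨a i, a_mem_MonM a i⟩ (adjoint (π ⟨a j, a_mem_MonM a j⟩) v) = 0 := by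
    have h : (⟨a i, a_mem_MonM a i⟩ : MonM a) * star ⟨a j, a_mem_MonM a j⟩ = 0 :=
      Subtype.ext (ha.mul_adjoint_of_ne hij)
    rw [hπstar, ← mul_apply_eq_comp, ← map_mul, h, map_zero, zero_apply]
  have hle (i j : ℤ) (hij : j ≤ i) (v : H) :
      adjoint (π ⟨a i, a_mem_MonM a i⟩) (adjoint (π ⟨a j, a_mem_MonM a j⟩) v) = 0 := by
    have h : star (⟨a i, a_mem_MonM a i⟩ : MonM a) * star ⟨a j, a_mem_MonM a j⟩ = 0 :=
      Subtype.ext (ha.adjoint_mul_adjoint_of_le hij)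
    rw [hπstar, hπstar, ← mul_apply_eq_comp, ← map_mul, h, map_zero, zero_apply]
  have hvac (i : ℤ) (v : H) (hv : ∀ k ≤ i, π ⟨a k, a_mem_MonM a k⟩ v = 0) :
      π ⟨a i, a_mem_MonM a i⟩ (adjoint (π ⟨a i, a_mem_MonM a i⟩) v) = v := by
    have h0 (k : {k : ℤ // k ≤ i}) :
        π ⟨(adjoint (a k)).comp (a k), ada_mem_MonM a k⟩ v = 0 := by
      have h : (⟨(adjoint (a k)).comp (a k), ada_mem_MonM a k⟩ : MonM a) =
          star ⟨a k, a_mem_MonM a k⟩ * ⟨a k, a_mem_MonM a k⟩ := rfl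
      rw [h, map_mul, mul_apply_eq_comp, hv k k.2, map_zero]
    have h : (⟨(a i).comp (adjoint (a i)), aad_mem_MonM a i⟩ : MonM a) =
        ⟨a i, a_mem_MonM a i⟩ * star ⟨a i, a_mem_MonM a i⟩ := rfl
    have h1 := hsum i v
    simp only [h0] at h1
    rw [hπstar, ← mul_apply_eq_comp, ← map_mul, ← h]
    exact (sub_eq_zero.1 (h1.unique hasSum_zero)).symm
  obtain ⟨V, hV⟩ := exists_intertwiner (ξ := ((‖ξ‖⁻¹ : ℝ) : ℂ) • ξ) hne hle hvac
    (fun i => by rw [map_smul, hξ, smul_zero]) ha (by simp [norm_smul, hξ0])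
  have hint := intertwines_of_generators hπcont V.toContinuousLinearMap hV
  have hsurj : V.range = ⊤ := by
    refine (hirr V.range V.isometry.isClosedEmbedding.isClosed_range ?_).resolve_left ?_
    · rintro x _ ⟨v, rfl⟩
      exact ⟨(x : MF →L[ℂ] MF) v, (hint x v).symm⟩
    · intro hbot
      have h : V (eS ∅) = 0 := LinearMap.congr_fun (LinearMap.range_eq_bot.1 hbot) (eS ∅)
      have h' := congrArg (fun w : MF => w ∅) ((map_eq_zero_iff V V.injective).1 h)
      simp [eS_apply] at h'
  exact ⟨LinearIsometryEquiv.ofSurjective V (LinearMap.range_eq_top.1 hsurj), hint⟩
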